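/- Let T be a minimal interval exchange transformation on [ℓ,r) defined over ℤ[√d], and let (Y_n)_{n≥1} be a sequence of semi-intervals contained in [ℓ,r), each with endpoints in ℤ[√d], such that the set {Π(Y_n) : n ≥ 1} is bounded. Then the sequence (S_n)_{n≥1}, where S_n is the transformation induced by T on Y_n, contains only finitely many distinct interval exchange transformations up to equivalence; i.e., the set of equivalence classes {[S_n] : n ≥ 1} is finite. -/

import Mathlib

open Set MeasureTheory

noncomputable section

/-- Left endpoint `γ i` of the `i`-th exchanged semi-interval. -/
def sepPt {s : ℕ} (l : ℝ) (len : Fin s → ℝ) (i : Fin s) : ℝ :=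
  l + ∑ j ∈ Finset.univ.filter (fun j => j < i), len j

/-- Left endpoint `δ` of the image of the `i`-th exchanged semi-interval. -/
def imgPt {s : ℕ} (l : ℝ) (len : Fin s → ℝ) (π : Equiv.Perm (Fin s)) (i : Fin s) : ℝ :=
  l + ∑ j ∈ Finset.univ.filter (fun j => π j < π i), len j

/-- `T` is the `s`-interval exchange transformation on `[l,r)` with lengths `len`
and permutation `π`, extended by the identity outside `[l,r)`. -/
def IsIET (s : ℕ) (l r : ℝ) (len : Fin s → ℝ) (π : Equiv.Perm (Fin s))
    (T : Equiv.Perm ℝ) : Prop :=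
  l < r ∧ (∀ i, 0 < len i) ∧ (∑ i, len i) = r - l ∧
  (∀ z, z ∉ Set.Ico l r → T z = z) ∧
  ∀ i : Fin s, ∀ z ∈ Set.Ico (sepPt l len i) (sepPt l len i + len i),
    T z = z + (imgPt l len π i - sepPt l len i)

/-- The two-sided orbit `{T^n z : n ∈ ℤ}`. -/
def orbitZ (T : Equiv.Perm ℝ) (z : ℝ) : Set ℝ := {w | ∃ n : ℤ, (T ^ n) z = w}

/-- Regularity (idoc): the orbits of the nonzero separation points are infinite
and pairwise disjoint. -/
def IsRegularIET (s : ℕ) (l : ℝ) (len : Fin s → ℝ) (T : Equiv.Perm ℝ) : Prop :=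
  (∀ i : Fin s, (i : ℕ) ≠ 0 → (orbitZ T (sepPt l len i)).Infinite) ∧
  (∀ i j : Fin s, (i : ℕ) ≠ 0 → (j : ℕ) ≠ 0 → i ≠ j →
    Disjoint (orbitZ T (sepPt l len i)) (orbitZ T (sepPt l len j)))

/-- Minimality: every (two-sided) orbit of a point of `[l,r)` is dense in `[l,r)`. -/
def IsMinimalOn (T : Equiv.Perm ℝ) (l r : ℝ) : Prop :=
  ∀ z ∈ Set.Ico l r, Set.Ico l r ⊆ closure (orbitZ T z)

/-- First return time of `z` in `I` (defined via `sInf`; meaningful when `T` is minimal). -/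
def returnTime (T : Equiv.Perm ℝ) (I : Set ℝ) (z : ℝ) : ℕ :=
  sInf {n : ℕ | 0 < n ∧ (T ^ n) z ∈ I}

/-- The transformation induced by `T` on `I` (first-return map). -/
def inducedMap (T : Equiv.Perm ℝ) (I : Set ℝ) (z : ℝ) : ℝ :=
  (T ^ returnTime T I z) z

/-- The transformation induced by `T` on `[u,v)` is an interval exchange
transformation on `k` intervals with data `(lam, σ)`. -/
def InducedData (T : Equiv.Perm ℝ) (u v : ℝ) (k : ℕ) (lam : Fin k → ℝ)
    (σ : Equiv.Perm (Fin k)) : Prop :=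
  ∃ S : Equiv.Perm ℝ, IsIET k u v lam σ S ∧
    ∀ z ∈ Set.Ico u v, S z = inducedMap T (Set.Ico u v) z

/-- The semi-interval `[l,t)` is right admissible for `T`. -/
def RightAdmissible (s : ℕ) (l r : ℝ) (len : Fin s → ℝ) (T : Equiv.Perm ℝ)
    (t : ℝ) : Prop :=
  l < t ∧ t < r ∧ ∃ (i : Fin s) (k : ℤ), t = (T ^ k) (sepPt l len i) ∧
    (0 < k → ∀ h : ℤ, 0 < h → h < k → t < (T ^ h) (sepPt l len i)) ∧
    (k ≤ 0 → ∀ h : ℤ, k < h → h ≤ 0 → t < (T ^ h) (sepPt l len i))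

/-- `ρ⁺_{I,T}(z) = min {n > 0 : T^n z ∈ (u,v)}`. -/
def rhoPlusPt (T : Equiv.Perm ℝ) (u v z : ℝ) : ℕ :=
  sInf {n : ℕ | 0 < n ∧ (T ^ n) z ∈ Set.Ioo u v}

/-- `ρ⁻_{I,T}(z) = min {n ≥ 0 : T^{-n} z ∈ (u,v)}`. -/
def rhoMinusPt (T : Equiv.Perm ℝ) (u v z : ℝ) : ℕ :=
  sInf {n : ℕ | (T⁻¹ ^ n) z ∈ Set.Ioo u v}

/-- The set of neighbours `N_{I,T}(z)` of `z` with respect to `I = [u,v)` and `T`. -/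
def neighbours (T : Equiv.Perm ℝ) (u v z : ℝ) : Set ℝ :=
  {w | ∃ k : ℤ, -(rhoMinusPt T u v z : ℤ) ≤ k ∧ k < (rhoPlusPt T u v z : ℤ) ∧
    w = (T ^ k) z}

/-- The set of division points `Div(I,T)` of `I = [u,v)` with respect to `T`. -/
def divPoints (s : ℕ) (l : ℝ) (len : Fin s → ℝ) (T : Equiv.Perm ℝ)
    (u v : ℝ) : Set ℝ :=
  ⋃ i : Fin s, neighbours T u v (sepPt l len i)

/-- The semi-interval `[u,v) ⊆ [l,r)` is admissible for `T`. -/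
def Admissible (s : ℕ) (l r : ℝ) (len : Fin s → ℝ) (T : Equiv.Perm ℝ)
    (u v : ℝ) : Prop :=
  l ≤ u ∧ u < v ∧ v ≤ r ∧
  u ∈ divPoints s l len T u v ∪ {r} ∧ v ∈ divPoints s l len T u v ∪ {r}

/-- A bundled regular `s`-interval exchange transformation. -/
structure RIET (s : ℕ) where
  l : ℝ
  r : ℝ
  len : Fin s → ℝ
  perm : Equiv.Perm (Fin s)
  T : Equiv.Perm ℝ
  isIET : IsIET s l r len perm T
  isReg : IsRegularIET s l len T

/-- The right endpoint `max (γ_s, δ_{π(s)})` of `Z(T)`. -/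
def zPoint {s : ℕ} (X : RIET s) : ℝ :=
  if h : 0 < s then
    max (sepPt X.l X.len ⟨s - 1, by omega⟩)
      (imgPt X.l X.len X.perm (X.perm.symm ⟨s - 1, by omega⟩))
  else X.r

/-- The left endpoint `min (γ_2, δ_{π(2)})` of `Y(T)`. -/
def yPoint {s : ℕ} (X : RIET s) : ℝ :=
  if h : 1 < s then
    min (sepPt X.l X.len ⟨1, h⟩) (imgPt X.l X.len X.perm (X.perm.symm ⟨1, h⟩))
  else X.l

/-- `Y = ψ(X)`: one step of the right Rauzy induction. -/
def PsiStep {s : ℕ} (X Y : RIET s) : Prop :=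
  Y.l = X.l ∧ Y.r = zPoint X ∧
  ∀ z ∈ Set.Ico X.l (zPoint X), Y.T z = inducedMap X.T (Set.Ico X.l (zPoint X)) z

/-- `Y = φ(X)`: one step of the left Rauzy induction. -/
def PhiStep {s : ℕ} (X Y : RIET s) : Prop :=
  Y.l = yPoint X ∧ Y.r = X.r ∧
  ∀ z ∈ Set.Ico (yPoint X) X.r, Y.T z = inducedMap X.T (Set.Ico (yPoint X) X.r) z

/-- Equivalence of two `s`-interval exchange transformations: `(σ, mu)` is obtained
from `(π, lam)` by rescaling, possibly combined with the reversal `τ : i ↦ s - i + 1`. -/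
def IETEquiv (s : ℕ) (π σ : Equiv.Perm (Fin s)) (lam mu : Fin s → ℝ) : Prop :=
  (∃ c : ℝ, 0 < c ∧ σ = π ∧ ∀ i, mu i = c * lam i) ∨
  (∃ c : ℝ, 0 < c ∧ (∀ i, σ i = (π i).rev) ∧ ∀ i, mu i = c * lam i.rev)

/-- The subring `ℤ[√d]` of `ℝ`. -/
def Zsd (d : ℤ) : Set ℝ := {z | ∃ m n : ℤ, z = (m : ℝ) + (n : ℝ) * Real.sqrt d}

/-- `Ψ(z) = max (|m|,|n|)` for `z = m + n√d` (the representation being unique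
when `d ≥ 2` is squarefree). -/
def PsiNum (d : ℤ) (z : ℝ) : ℕ :=
  sInf {k : ℕ | ∃ m n : ℤ, z = (m : ℝ) + (n : ℝ) * Real.sqrt d ∧
    k = max m.natAbs n.natAbs}

/-- `Ψ(S) = max {Ψ(z) : z ∈ ∂S}`. -/
def PsiSet (d : ℤ) (S : Set ℝ) : ℕ := sSup (PsiNum d '' frontier S)

/-- The reduced complexity `Π(S) = |S| ⬝ Ψ(S)`. -/
def PiSet (d : ℤ) (S : Set ℝ) : ℝ := (volume S).toReal * PsiSet d S

/-- `S` belongs to the algebra `A([l,r))`: a nonempty finite union of semi-intervals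
of `[l,r)` with endpoints in `ℤ[√d]`. -/
def MemA (d : ℤ) (l r : ℝ) (S : Set ℝ) : Prop :=
  S.Nonempty ∧ S ⊆ Set.Ico l r ∧
  ∃ (k : ℕ) (a b : Fin k → ℝ), (∀ j, a j ∈ Zsd d ∧ b j ∈ Zsd d ∧ a j < b j) ∧
    S = ⋃ j, Set.Ico (a j) (b j)

/-- The interval exchange transformation with data `(l, r, len, π)` is defined over
`ℤ[√d]`: `l`, `r`, the separation points and the translation values lie in `ℤ[√d]`. -/
def DefinedOverZ (d : ℤ) (s : ℕ) (l r : ℝ) (len : Fin s → ℝ)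
    (π : Equiv.Perm (Fin s)) : Prop :=
  l ∈ Zsd d ∧ r ∈ Zsd d ∧
  ∀ i, sepPt l len i ∈ Zsd d ∧ (imgPt l len π i - sepPt l len i) ∈ Zsd d

/-- Maximal positive return time `ρ⁺(S)`. -/
def rhoPlusSet (T : Equiv.Perm ℝ) (S : Set ℝ) : ℕ :=
  sInf {n : ℕ | 1 ≤ n ∧ ⇑(T ^ n) '' S ⊆ ⋃ i ∈ Finset.range n, ⇑(T ^ i) '' S}

/-- Maximal negative return time `ρ⁻(S)`. -/
def rhoMinusSet (T : Equiv.Perm ℝ) (S : Set ℝ) : ℕ :=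
  sInf {m : ℕ | 1 ≤ m ∧ ⇑(T ^ m) '' S ⊆ ⋃ i ∈ Finset.range m, ⇑(T⁻¹ ^ i) '' S}

/-- Minimal positive return time `σ⁺(S)`. -/
def sigmaPlusSet (T : Equiv.Perm ℝ) (S : Set ℝ) : ℕ :=
  sInf {n : ℕ | 1 ≤ n ∧ (⇑(T ^ n) '' S ∩ S).Nonempty}

/-- Minimal negative return time `σ⁻(S)`. -/
def sigmaMinusSet (T : Equiv.Perm ℝ) (S : Set ℝ) : ℕ :=
  sInf {m : ℕ | 1 ≤ m ∧ (⇑(T⁻¹ ^ m) '' S ∩ S).Nonempty}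

/-- `D_{m,n}(T) = ⋃_{i=-m+1}^{n} T^i (Sep(T))`. -/
def Dmn (s : ℕ) (l : ℝ) (len : Fin s → ℝ) (T : Equiv.Perm ℝ) (m n : ℕ) : Set ℝ :=
  {w | ∃ (i : Fin s) (k : ℤ), -(m : ℤ) + 1 ≤ k ∧ k ≤ (n : ℤ) ∧
    w = (T ^ k) (sepPt l len i)}

/-- `[u,v)` belongs to `U(T) = ⋃_{m,n ≥ 1} U_{m,n}(T)`: it is one of the
semi-intervals into which `D_{m,n}(T)` partitions `[l,r)`. -/
def MemU (s : ℕ) (l r : ℝ) (len : Fin s → ℝ) (T : Equiv.Perm ℝ) (u v : ℝ) : Prop :=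
  ∃ m n : ℕ, 1 ≤ m ∧ 1 ≤ n ∧ u ∈ Dmn s l len T m n ∧
    (v ∈ Dmn s l len T m n ∨ v = r) ∧ ∀ w ∈ Dmn s l len T m n, w ∉ Set.Ioo u v

/-- `x = m + n√d` with integers `m`, `n` such that the conjugate `m - n√d` is at most `C` in
absolute value. -/
def ConjBound (d : ℤ) (C x : ℝ) : Prop :=
  ∃ m n : ℤ, x = m + n * √d ∧ |(m : ℝ) - n * √d| ≤ C

namespace ConjBound

variable {d : ℤ} {C C' x y : ℝ}

protected theorem mono (h : ConjBound d C x) (hC : C ≤ C') : ConjBound d C' x := by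
  obtain ⟨m, n, hx, hmn⟩ := h
  exact ⟨m, n, hx, hmn.trans hC⟩

protected theorem zero : ConjBound d 0 0 := ⟨0, 0, by simp, by simp⟩

protected theorem add (hx : ConjBound d C x) (hy : ConjBound d C' y) : ConjBound d (C + C') (x + y) := by
  obtain ⟨m, n, rfl, h⟩ := hx
  obtain ⟨m', n', rfl, h'⟩ := hy
  refine ⟨m + m', n + n', by push_cast; ring, ?_⟩
  calc |((m + m' : ℤ) : ℝ) - (n + n' : ℤ) * √d|
      = |((m : ℝ) - n * √d) + (m' - n' * √d)| := by push_cast; ring_nf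
    _ ≤ C + C' := (abs_add_le _ _).trans (add_le_add h h')

protected theorem neg (hx : ConjBound d C x) : ConjBound d C (-x) := by
  obtain ⟨m, n, rfl, h⟩ := hx
  refine ⟨-m, -n, by push_cast; ring, ?_⟩
  rw [← abs_neg] at h
  convert h using 2
  push_cast
  ring

protected theorem sub (hx : ConjBound d C x) (hy : ConjBound d C' y) : ConjBound d (C + C') (x - y) := by
  simpa [sub_eq_add_neg] using hx.add hy.neg

protected theorem max (hx : ConjBound d C x) (hy : ConjBound d C y) : ConjBound d C (Max.max x y) := by
  rcases max_choice x y with h | h <;> rwa [h]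

protected theorem min (hx : ConjBound d C x) (hy : ConjBound d C y) : ConjBound d C (Min.min x y) := by
  rcases min_choice x y with h | h <;> rwa [h]

theorem one_le_mul_of_pos (hd : Irrational √d) (hx : ConjBound d C x) (hx0 : 0 < x) :
    1 ≤ x * C := by
  obtain ⟨m, n, rfl, h⟩ := hx
  have hd0 : (0 : ℝ) ≤ d := by
    by_contra! h0
    exact hd ⟨0, by rw [Real.sqrt_eq_zero_of_nonpos h0.le]; simp⟩
  have hsq : √(d : ℝ) * √d = d := Real.mul_self_sqrt hd0
  have hconj : (m : ℝ) - n * √d ≠ 0 := by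
    intro h0
    rcases eq_or_ne n 0 with rfl | hn
    · simp at h0
      simp [h0] at hx0
    · exact (hd.intCast_mul hn) ⟨m, by push_cast; linarith⟩
  have hprod : ((m : ℝ) + n * √d) * (m - n * √d) = ((m * m - d * (n * n) : ℤ) : ℝ) := by
    push_cast
    linear_combination (-(n : ℝ) * n) * hsq
  have hne : (m * m - d * (n * n) : ℤ) ≠ 0 := by
    intro h0
    rw [h0, Int.cast_zero] at hprod
    exact (mul_ne_zero hx0.ne' hconj) hprod
  have h1 : (1 : ℝ) ≤ |((m * m - d * (n * n) : ℤ) : ℝ)| := by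
    exact_mod_cast Int.one_le_abs hne
  rw [← hprod, abs_mul, abs_of_pos hx0] at h1
  exact h1.trans (mul_le_mul_of_nonneg_left h hx0.le)

theorem finite_setOf (hd : 1 ≤ d) (C : ℝ) : {x | ConjBound d C x ∧ |x| ≤ C}.Finite := by
  refine ((((Set.finite_Icc (-⌈C⌉) ⌈C⌉).prod (Set.finite_Icc (-⌈C⌉) ⌈C⌉))).image
    (fun p : ℤ × ℤ => (p.1 : ℝ) + p.2 * √d)).subset ?_
  rintro _ ⟨⟨m, n, rfl, h⟩, h'⟩
  have hs : (1 : ℝ) ≤ √d := Real.one_le_sqrt.2 (by exact_mod_cast hd)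
  have hC := Int.le_ceil C
  rw [abs_le] at h h'
  have hn : |(n : ℝ)| ≤ C := by
    have h2 : |(n : ℝ)| * √d ≤ C := by
      rw [← abs_of_nonneg (zero_le_one.trans hs), ← abs_mul, abs_le]
      constructor <;> linarith
    exact (le_mul_of_one_le_right (abs_nonneg _) hs).trans h2
  rw [abs_le] at hn
  refine ⟨(m, n), ⟨⟨?_, ?_⟩, ?_, ?_⟩, rfl⟩ <;> dsimp only <;>
    rw [← Int.cast_le (R := ℝ)] <;> push_cast <;> linarith

end ConjBound

/-- A nontrivial unit of norm one scales elements up and their conjugates down. -/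
theorem exists_unit_scaling {d : ℤ} (hd : 0 < d) (hsq : ¬ IsSquare d) :
    ∃ η : ℝ, 1 < η ∧ ∀ (k : ℕ) (C x : ℝ), ConjBound d C x → ConjBound d (C / η ^ k) (η ^ k * x) := by
  obtain ⟨a, hax, hay⟩ := Pell.Solution₁.exists_pos_of_not_isSquare hd hsq
  have hs : √(d : ℝ) * √d = d := Real.mul_self_sqrt (by exact_mod_cast hd.le)
  have hprop : (a.x : ℝ) ^ 2 - d * a.y ^ 2 = 1 := by exact_mod_cast a.prop
  have hη : 1 < (a.x : ℝ) + a.y * √d := by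
    have h1 : (1 : ℝ) < a.x := by exact_mod_cast hax
    have h2 : (0 : ℝ) < a.y := by exact_mod_cast hay
    have := mul_nonneg h2.le (Real.sqrt_nonneg (d : ℝ))
    linarith
  refine ⟨_, hη, ?_⟩
  set η := (a.x : ℝ) + a.y * √d with hηdef
  have hη0 : 0 < η := by linarith
  have hconj : (a.x : ℝ) - a.y * √d = η⁻¹ := by
    refine eq_inv_of_mul_eq_one_left ?_
    rw [hηdef]
    linear_combination hprop - (a.y : ℝ) ^ 2 * hs
  intro k
  induction k with
  | zero => simp
  | succ k ih =>
    intro C x hx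
    obtain ⟨m, n, hmn, h⟩ := ih C x hx
    refine ⟨a.x * m + d * (a.y * n), a.x * n + a.y * m, ?_, ?_⟩
    · rw [pow_succ', mul_assoc, hmn, hηdef]
      push_cast
      linear_combination (a.y : ℝ) * n * hs
    · have : ((a.x * m + d * (a.y * n) : ℤ) : ℝ) - (a.x * n + a.y * m : ℤ) * √d
          = η⁻¹ * (m - n * √d) := by
        rw [← hconj]
        push_cast
        linear_combination (-(a.y : ℝ) * n) * hs
      rw [this, abs_mul, abs_of_pos (inv_pos.2 hη0), pow_succ, ← div_div, div_eq_inv_mul _ η]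
      exact mul_le_mul_of_nonneg_left h (inv_pos.2 hη0).le

theorem ConjBound.of_mem_Zsd {d : ℤ} {x : ℝ} (hx : x ∈ Zsd d) :
    ConjBound d ((1 + √d) * PsiNum d x) x := by
  have hne : {k : ℕ | ∃ m n : ℤ, x = (m : ℝ) + (n : ℝ) * √d ∧
      k = max m.natAbs n.natAbs}.Nonempty := by
    obtain ⟨m, n, h⟩ := hx
    exact ⟨_, m, n, h, rfl⟩
  obtain ⟨m, n, h, hk⟩ := Nat.sInf_mem hne
  refine ⟨m, n, h, ?_⟩
  change PsiNum d x = _ at hk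
  have hm : |(m : ℝ)| ≤ PsiNum d x := by
    rw [hk, ← Int.cast_abs, ← Nat.cast_natAbs]
    exact_mod_cast le_max_left _ _
  have hn : |(n : ℝ)| ≤ PsiNum d x := by
    rw [hk, ← Int.cast_abs, ← Nat.cast_natAbs]
    exact_mod_cast le_max_right _ _
  calc |(m : ℝ) - n * √d| ≤ |(m : ℝ)| + |(n : ℝ) * √d| := abs_sub _ _
    _ = |(m : ℝ)| + |(n : ℝ)| * √d := by rw [abs_mul, abs_of_nonneg (Real.sqrt_nonneg _)]
    _ ≤ PsiNum d x + PsiNum d x * √d := by gcongr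
    _ = _ := by ring

/-- Both endpoints of a semi-interval have conjugates controlled by its reduced complexity. -/
theorem ConjBound.of_PiSet_le {d : ℤ} {u v B : ℝ} (huv : u < v) (hu : u ∈ Zsd d) (hv : v ∈ Zsd d)
    (hB : PiSet d (Ico u v) ≤ B) :
    ConjBound d ((1 + √d) * B / (v - u)) u ∧ ConjBound d ((1 + √d) * B / (v - u)) v := by
  have hlen : 0 < v - u := sub_pos.2 huv
  have hPsi : (PsiSet d (Ico u v) : ℝ) ≤ B / (v - u) := by
    rw [le_div_iff₀' hlen]
    simpa [PiSet, huv.le] using hB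
  have hfin : (PsiNum d '' frontier (Ico u v)).Finite := by
    rw [frontier_Ico huv]
    exact (Set.toFinite _).image _
  have key : ∀ x ∈ frontier (Ico u v), x ∈ Zsd d → ConjBound d ((1 + √d) * B / (v - u)) x := by
    intro x hx hxZ
    refine (ConjBound.of_mem_Zsd hxZ).mono ?_
    rw [mul_div_assoc]
    refine mul_le_mul_of_nonneg_left (le_trans ?_ hPsi) (by positivity)
    exact_mod_cast le_csSup hfin.bddAbove (Set.mem_image_of_mem _ hx)
  rw [frontier_Ico huv] at key
  exact ⟨key u (by simp) hu, key v (by simp) hv⟩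

/-- Pairwise disjoint semi-intervals inside `[x,y)` have total length at most `y - x`. -/
theorem sum_length_le_of_pairwiseDisjoint_Ico {ι : Type*} (t : Finset ι) (a b : ι → ℝ) {x y : ℝ}
    (hxy : x ≤ y) (hab : ∀ i ∈ t, a i ≤ b i) (hsub : ∀ i ∈ t, Ico (a i) (b i) ⊆ Ico x y)
    (hdisj : (t : Set ι).PairwiseDisjoint fun i => Ico (a i) (b i)) :
    ∑ i ∈ t, (b i - a i) ≤ y - x := by
  have h1 : volume (⋃ i ∈ t, Ico (a i) (b i)) = ∑ i ∈ t, volume (Ico (a i) (b i)) :=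
    measure_biUnion_finset hdisj fun i _ => measurableSet_Ico
  have h2 : volume (⋃ i ∈ t, Ico (a i) (b i)) ≤ volume (Ico x y) :=
    measure_mono (Set.iUnion₂_subset hsub)
  rw [h1] at h2
  simp only [Real.volume_Ico] at h2
  rw [← ENNReal.ofReal_sum_of_nonneg fun i hi => sub_nonneg.2 (hab i hi)] at h2
  exact (ENNReal.ofReal_le_ofReal_iff (sub_nonneg.2 hxy)).1 h2

theorem sepPt_add_len {s : ℕ} (l : ℝ) (len : Fin s → ℝ) (i : Fin s) :
    sepPt l len i + len i = l + ∑ j ∈ Finset.univ.filter (fun j => j ≤ i), len j := by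
  have : Finset.univ.filter (fun j => j ≤ i) = insert i (Finset.univ.filter fun j => j < i) := by
    ext j
    simp [le_iff_eq_or_lt]
  rw [this, Finset.sum_insert (by simp), sepPt]
  ring

theorem sepPt_add_len_eq_sepPt {s : ℕ} (l : ℝ) (len : Fin s → ℝ) (i : Fin s)
    (h : (i : ℕ) + 1 < s) : sepPt l len i + len i = sepPt l len ⟨i + 1, h⟩ := by
  rw [sepPt_add_len, sepPt]
  congr 2
  ext j
  simp only [Finset.mem_filter, Finset.mem_univ, true_and, Fin.le_def, Fin.lt_def]
  omega

theorem sepPt_add_len_eq_right {s : ℕ} (l : ℝ) (len : Fin s → ℝ) (i : Fin s)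
    (h : ¬ (i : ℕ) + 1 < s) : sepPt l len i + len i = l + ∑ j, len j := by
  rw [sepPt_add_len, Finset.filter_true_of_mem]
  intro j _
  rw [Fin.le_def]
  omega

/-- The exchanged semi-intervals cover `[l, l + ∑ len)`. -/
theorem exists_mem_Ico_sepPt {s : ℕ} (l : ℝ) (len : Fin s → ℝ) {y : ℝ}
    (hy : y ∈ Ico l (l + ∑ i, len i)) :
    ∃ i, y ∈ Ico (sepPt l len i) (sepPt l len i + len i) := by
  have hs : 0 < s := by
    by_contra! h
    obtain rfl : s = 0 := by omega
    simp at hy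
  have hne : (Finset.univ.filter fun i => sepPt l len i ≤ y).Nonempty := by
    refine ⟨⟨0, hs⟩, ?_⟩
    have : (Finset.univ.filter fun j : Fin s => j < ⟨0, hs⟩) = ∅ := by
      ext j
      simp [Fin.lt_def]
    rw [Finset.mem_filter, sepPt, this]
    simpa using hy.1
  obtain ⟨i, hi, hmax⟩ := Finset.exists_max_image _ id hne
  simp only [Finset.mem_filter, Finset.mem_univ, true_and, id] at hi hmax
  refine ⟨i, hi, ?_⟩
  by_cases h : (i : ℕ) + 1 < s
  · rw [sepPt_add_len_eq_sepPt l len i h]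
    by_contra! h'
    have := hmax _ h'
    rw [Fin.le_def] at this
    simp at this
  · rw [sepPt_add_len_eq_right l len i h]
    exact hy.2

theorem imgPt_eq_sepPt {s : ℕ} (l : ℝ) (len : Fin s → ℝ) (π : Equiv.Perm (Fin s)) (i : Fin s) :
    imgPt l len π i = sepPt l (len ∘ π.symm) (π i) := by
  rw [imgPt, sepPt]
  congr 1
  refine Finset.sum_equiv π (by simp) (by simp)

theorem exists_mem_Ico_imgPt {s : ℕ} (l : ℝ) (len : Fin s → ℝ) (π : Equiv.Perm (Fin s)) {y : ℝ}
    (hy : y ∈ Ico l (l + ∑ i, len i)) :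
    ∃ i, y ∈ Ico (imgPt l len π i) (imgPt l len π i + len i) := by
  have hsum : ∑ i, (len ∘ π.symm) i = ∑ i, len i := Equiv.sum_comp π.symm len
  obtain ⟨i, hi⟩ := exists_mem_Ico_sepPt l (len ∘ π.symm) (by rwa [hsum])
  refine ⟨π.symm i, ?_⟩
  simpa [imgPt_eq_sepPt] using hi

theorem imgPt_add_len_le {s : ℕ} {l : ℝ} {len : Fin s → ℝ} (hpos : ∀ i, 0 < len i)
    (π : Equiv.Perm (Fin s)) (i : Fin s) : l ≤ imgPt l len π i ∧
      imgPt l len π i + len i ≤ l + ∑ j, len j := by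
  refine ⟨le_add_of_nonneg_right (Finset.sum_nonneg fun j _ => (hpos j).le), ?_⟩
  have hi : i ∉ Finset.univ.filter fun j => π j < π i := by simp
  rw [imgPt, add_assoc, add_comm (Finset.sum _ _), ← Finset.sum_insert hi]
  gcongr
  · exact fun j _ _ => (hpos j).le
  · exact Finset.subset_univ _

/-- The rank permutation of an injective real-valued family. -/
theorem exists_perm_lt_iff_lt {j : ℕ} {q : Fin j → ℝ} (hq : Function.Injective q) :
    ∃ σ : Equiv.Perm (Fin j), ∀ i i', σ i < σ i' ↔ q i < q i' := by
  have hmono : StrictMono (q ∘ Tuple.sort q) :=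
    (Tuple.monotone_sort q).strictMono_of_injective (hq.comp (Tuple.sort q).injective)
  refine ⟨(Tuple.sort q)⁻¹, fun i i' => ?_⟩
  rw [← hmono.lt_iff_lt]
  simp

theorem sepPt_diff {j : ℕ} (e : Fin (j + 1) → ℝ) (i : Fin j) :
    sepPt (e 0) (fun i => e i.succ - e i.castSucc) i = e i.castSucc := by
  obtain ⟨n, hn⟩ := i
  induction n with
  | zero =>
    have : (Finset.univ.filter fun i : Fin j => i < ⟨0, hn⟩) = ∅ := by
      ext i
      simp [Fin.lt_def]
    rw [sepPt, this]
    simp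
  | succ n ih =>
    have := ih (by omega)
    rw [← sepPt_add_len_eq_sepPt _ _ ⟨n, by omega⟩ hn, this]
    simp

theorem sum_diff {j : ℕ} (e : Fin (j + 1) → ℝ) :
    ∑ i : Fin j, (e i.succ - e i.castSucc) = e (Fin.last j) - e 0 := by
  rw [Finset.sum_sub_distrib]
  have h1 := Fin.sum_univ_succ e
  have h2 := Fin.sum_univ_castSucc e
  linarith

/-- An injective self-map of `[u,v)` which is a translation on each semi-interval of a finite
partition is an interval exchange transformation. -/
theorem exists_isIET_of_translation {j : ℕ} {e : Fin (j + 1) → ℝ} (he : StrictMono e)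
    {u v : ℝ} (hu : e 0 = u) (hv : e (Fin.last j) = v) (huv : u < v) {S : ℝ → ℝ}
    (hmaps : MapsTo S (Ico u v) (Ico u v)) (hinj : InjOn S (Ico u v))
    (htr : ∀ i : Fin j, ∀ w ∈ Ico (e i.castSucc) (e i.succ),
      S w - w = S (e i.castSucc) - e i.castSucc) :
    ∃ (σ : Equiv.Perm (Fin j)) (S' : Equiv.Perm ℝ),
      IsIET j u v (fun i => e i.succ - e i.castSucc) σ S' ∧ ∀ z ∈ Ico u v, S' z = S z := by
  subst hu hv
  set len : Fin j → ℝ := fun i => e i.succ - e i.castSucc with hlen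
  have hpos : ∀ i, 0 < len i := fun i => sub_pos.2 (he Fin.castSucc_lt_succ)
  have hsum : ∑ i, len i = e (Fin.last j) - e 0 := sum_diff e
  have hsub : ∀ i : Fin j, Ico (e i.castSucc) (e i.succ) ⊆ Ico (e 0) (e (Fin.last j)) :=
    fun i => Ico_subset_Ico (he.monotone (Fin.zero_le _)) (he.monotone (Fin.le_last _))
  have hleft : ∀ i : Fin j, e i.castSucc ∈ Ico (e i.castSucc) (e i.succ) :=
    fun i => ⟨le_rfl, he Fin.castSucc_lt_succ⟩
  set q : Fin j → ℝ := fun i => S (e i.castSucc) with hq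
  have hqinj : Function.Injective q := by
    intro i i' h
    have := he.injective (hinj (hsub i (hleft i)) (hsub i' (hleft i')) h)
    exact Fin.castSucc_injective _ this
  -- every point of an image semi-interval is the image of the corresponding point
  have hpre : ∀ i, ∀ y ∈ Ico (q i) (q i + len i),
      y - q i + e i.castSucc ∈ Ico (e i.castSucc) (e i.succ) ∧
        S (y - q i + e i.castSucc) = y := by
    intro i y hy
    have hmem : y - q i + e i.castSucc ∈ Ico (e i.castSucc) (e i.succ) := by
      have h1 := hy.1
      have h2 := hy.2
      simp only [hlen] at h2
      constructor <;> linarith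
    refine ⟨hmem, ?_⟩
    have := htr i _ hmem
    simp only [hq] at this ⊢
    linarith
  have himg : ∀ i, Ico (q i) (q i + len i) ⊆ Ico (e 0) (e (Fin.last j)) := by
    intro i y hy
    obtain ⟨h1, h2⟩ := hpre i y hy
    rw [← h2]
    exact hmaps (hsub i h1)
  have hdisj : Pairwise fun i i' => Disjoint (Ico (q i) (q i + len i))
      (Ico (q i') (q i' + len i')) := by
    intro i i' hii'
    rw [Set.disjoint_left]
    intro y hy hy'
    obtain ⟨h1, h2⟩ := hpre i y hy
    obtain ⟨h1', h2'⟩ := hpre i' y hy'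
    have heq := hinj (hsub i h1) (hsub i' h1') (h2.trans h2'.symm)
    rw [heq] at h1
    rcases lt_or_gt_of_ne hii' with h | h
    · have : e i.succ ≤ e i'.castSucc := he.monotone (Fin.succ_le_castSucc_iff.2 h)
      linarith [h1.2, h1'.1]
    · have : e i'.succ ≤ e i.castSucc := he.monotone (Fin.succ_le_castSucc_iff.2 h)
      linarith [h1.1, h1'.2]
  have hsep : ∀ i i', q i < q i' → q i + len i ≤ q i' := by
    intro i i' h
    by_contra! h'
    have hne : i ≠ i' := by
      rintro rfl
      exact h.false
    exact Set.disjoint_left.1 (hdisj hne) ⟨h.le, h'⟩ ⟨le_rfl, by linarith [hpos i']⟩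
  obtain ⟨σ, hσ⟩ := exists_perm_lt_iff_lt hqinj
  have hbounds : ∀ i, e 0 ≤ q i ∧ q i + len i ≤ e (Fin.last j) := by
    intro i
    exact (Set.Ico_subset_Ico_iff (by linarith [hpos i])).1 (himg i)
  have himgPt : ∀ i, imgPt (e 0) len σ i = q i := by
    intro i
    have hlt := sum_length_le_of_pairwiseDisjoint_Ico (Finset.univ.filter fun i' => q i' < q i)
      q (fun i => q i + len i) (hbounds i).1 (fun i' _ => by linarith [hpos i'])
      (fun i' hi' => Ico_subset_Ico (hbounds i').1 (hsep _ _ (Finset.mem_filter.1 hi').2))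
      (hdisj.set_pairwise _)
    have hge := sum_length_le_of_pairwiseDisjoint_Ico (Finset.univ.filter fun i' => ¬ q i' < q i)
      q (fun i => q i + len i) ((le_add_of_nonneg_right (hpos i).le).trans (hbounds i).2)
      (fun i' _ => by linarith [hpos i'])
      (fun i' hi' => Ico_subset_Ico (not_lt.1 (Finset.mem_filter.1 hi').2) (hbounds i').2)
      (hdisj.set_pairwise _)
    simp only [add_sub_cancel_left] at hlt hge
    have htot := Finset.sum_filter_add_sum_filter_not Finset.univ (fun i' => q i' < q i) len
    simp only [imgPt, hσ]
    linarith
  have hsepPt : ∀ i, sepPt (e 0) len i = e i.castSucc := sepPt_diff e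
  have hsurj : SurjOn S (Ico (e 0) (e (Fin.last j))) (Ico (e 0) (e (Fin.last j))) := by
    intro y hy
    obtain ⟨i, hi⟩ := exists_mem_Ico_imgPt (e 0) len σ (y := y)
      (by rwa [hsum, add_sub_cancel])
    rw [himgPt] at hi
    obtain ⟨h1, h2⟩ := hpre i y hi
    exact ⟨_, hsub i h1, h2⟩
  have hbij : Function.Bijective
      ((Ico (e 0) (e (Fin.last j))).piecewise S id) := by
    constructor
    · rw [Set.injective_piecewise_iff]
      refine ⟨hinj, Function.injective_id.injOn, fun x hx y hy h => hy ?_⟩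
      rw [id] at h
      exact h ▸ hmaps hx
    · intro y
      by_cases hy : y ∈ Ico (e 0) (e (Fin.last j))
      · obtain ⟨x, hx, hxy⟩ := hsurj hy
        exact ⟨x, by rw [Set.piecewise_eq_of_mem _ _ _ hx, hxy]⟩
      · exact ⟨y, by rw [Set.piecewise_eq_of_notMem _ _ _ hy, id]⟩
  refine ⟨σ, Equiv.ofBijective _ hbij, ⟨huv, hpos, hsum, fun z hz => ?_, fun i z hz => ?_⟩,
    fun z hz => ?_⟩
  · exact Set.piecewise_eq_of_notMem _ _ _ hz
  · have hz' : z ∈ Ico (e i.castSucc) (e i.succ) := by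
      rw [hsepPt] at hz
      simpa [hlen] using hz
    rw [himgPt, hsepPt, Equiv.ofBijective_apply, Set.piecewise_eq_of_mem _ _ _ (hsub i hz')]
    linarith [htr i z hz']
  · exact Set.piecewise_eq_of_mem _ _ _ hz

/-- `T` maps `[l,r)` into itself and is locally a translation there, with data in `ℤ[√d]` whose
conjugates are at most `C`. -/
def IsZsdTranslation (d : ℤ) (C l r : ℝ) (T : Equiv.Perm ℝ) : Prop :=
  MapsTo T (Ico l r) (Ico l r) ∧
  ∀ z ∈ Ico l r, ∃ p q α : ℝ, p ≤ z ∧ z < q ∧ ConjBound d C p ∧ ConjBound d C q ∧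
    ConjBound d C α ∧ ∀ w ∈ Ico p q, T w = w + α

theorem exists_isZsdTranslation {d : ℤ} {s : ℕ} {l r : ℝ} {len : Fin s → ℝ}
    {π : Equiv.Perm (Fin s)} {T : Equiv.Perm ℝ} (hIET : IsIET s l r len π T)
    (hdef : DefinedOverZ d s l r len π) : ∃ C, 0 ≤ C ∧ IsZsdTranslation d C l r T := by
  obtain ⟨-, hpos, hsum, -, htr⟩ := hIET
  obtain ⟨-, hr, hsep⟩ := hdef
  have hsum' : l + ∑ i, len i = r := by linarith
  have hloc : ∀ i, ∃ C : ℝ, ConjBound d C (sepPt l len i) ∧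
      ConjBound d C (sepPt l len i + len i) ∧
      ConjBound d C (imgPt l len π i - sepPt l len i) := by
    intro i
    have hright : sepPt l len i + len i ∈ Zsd d := by
      by_cases h : (i : ℕ) + 1 < s
      · rw [sepPt_add_len_eq_sepPt l len i h]
        exact (hsep _).1
      · rw [sepPt_add_len_eq_right l len i h, hsum']
        exact hr
    exact ⟨_, (ConjBound.of_mem_Zsd (hsep i).1).mono ((le_max_left _ _).trans (le_max_left _ _)),
      (ConjBound.of_mem_Zsd hright).mono ((le_max_right _ _).trans (le_max_left _ _)),
      (ConjBound.of_mem_Zsd (hsep i).2).mono (le_max_right _ _)⟩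
  choose c hc using hloc
  obtain ⟨C, hC⟩ := (Set.finite_range c).bddAbove
  have hcC : ∀ i, c i ≤ max C 0 := fun i => (hC ⟨i, rfl⟩).trans (le_max_left _ _)
  refine ⟨max C 0, le_max_right _ _, fun z hz => ?_, fun z hz => ?_⟩
  · obtain ⟨i, hi⟩ := exists_mem_Ico_sepPt l len (hsum'.symm ▸ hz)
    obtain ⟨h1, h2⟩ := imgPt_add_len_le (l := l) hpos π i
    rw [htr i z hi]
    constructor <;> linarith [hi.1, hi.2]
  · obtain ⟨i, hi⟩ := exists_mem_Ico_sepPt l len (hsum'.symm ▸ hz)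
    exact ⟨_, _, _, hi.1, hi.2, (hc i).1.mono (hcC i), (hc i).2.1.mono (hcC i),
      (hc i).2.2.mono (hcC i), htr i⟩

namespace IsZsdTranslation

variable {d : ℤ} {C E l r u v z : ℝ} {T : Equiv.Perm ℝ}

theorem pow_mem (hT : IsZsdTranslation d C l r T) (hz : z ∈ Ico l r) (n : ℕ) :
    (T ^ n) z ∈ Ico l r := by
  induction n with
  | zero => simpa
  | succ n ih =>
    rw [pow_succ', Equiv.Perm.mul_apply]
    exact hT.1 ih

/-- Around each point of `[u,v)` there is a semi-interval, with controlled endpoints, on which the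
first `N` iterates of `T` are translations with the same itinerary with respect to `[u,v)`. -/
theorem exists_piece (hT : IsZsdTranslation d C l r T) (hC : 0 ≤ C)
    (hsub : Ico u v ⊆ Ico l r) (hu : ConjBound d E u) (hv : ConjBound d E v)
    (hz : z ∈ Ico u v) (N : ℕ) :
    ∃ a b, u ≤ a ∧ a ≤ z ∧ z < b ∧ b ≤ v ∧
      ConjBound d (E + C * (N + 1)) a ∧ ConjBound d (E + C * (N + 1)) b ∧
      ∀ i ≤ N, ∃ t, ConjBound d (C * i) t ∧ ∀ w ∈ Ico a b,
        (T ^ i) w = w + t ∧ ((T ^ i) w ∈ Ico u v ↔ (T ^ i) z ∈ Ico u v) := by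
  have hE : 0 ≤ E := by
    obtain ⟨m, n, -, h⟩ := hu
    exact (abs_nonneg _).trans h
  induction N with
  | zero =>
    refine ⟨u, v, le_rfl, hz.1, hz.2, le_rfl, hu.mono (by simpa), hv.mono (by simpa), ?_⟩
    intro i hi
    obtain rfl : i = 0 := by omega
    refine ⟨0, by simpa using ConjBound.zero, fun w hw => ?_⟩
    simpa using iff_of_true hw hz
  | succ N ih =>
    obtain ⟨a, b, hua, haz, hzb, hbv, ha, hb, hit⟩ := ih
    obtain ⟨t, ht, hit'⟩ := hit N le_rfl
    obtain ⟨p, q, α, hp, hq, hpC, hqC, hαC, hα⟩ := hT.2 _ (hT.pow_mem (hsub hz) N)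
    have hzN := (hit' z ⟨haz, hzb⟩).1
    rw [hzN] at hp hq
    have htα : ConjBound d (C * (N + 1 : ℕ)) (t + α) :=
      (ht.add hαC).mono (by push_cast; linarith)
    have hCN : 0 ≤ C * (N : ℝ) := by positivity
    -- the part of the piece on which the next iterate is a translation
    obtain ⟨a₁, b₁, ha₁, hb₁, ha₁z, hzb₁, ha₁C, hb₁C, htr⟩ : ∃ a₁ b₁, a ≤ a₁ ∧ b₁ ≤ b ∧ a₁ ≤ z ∧
        z < b₁ ∧ ConjBound d (E + C * ((N + 1 : ℕ) + 1)) a₁ ∧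
        ConjBound d (E + C * ((N + 1 : ℕ) + 1)) b₁ ∧
        ∀ w ∈ Ico a₁ b₁, (T ^ (N + 1)) w = w + (t + α) := by
      refine ⟨max a (p - t), min b (q - t), le_max_left _ _, min_le_left _ _,
        max_le haz (by linarith), lt_min hzb (by linarith),
        (ha.mono ?_).max ((hpC.sub ht).mono ?_), (hb.mono ?_).min ((hqC.sub ht).mono ?_), ?_⟩
      · push_cast; linarith
      · push_cast; linarith
      · push_cast; linarith
      · push_cast; linarith
      · rintro w ⟨hw1, hw2⟩
        rw [max_le_iff] at hw1
        rw [lt_min_iff] at hw2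
        rw [pow_succ', Equiv.Perm.mul_apply, (hit' w ⟨hw1.1, hw2.1⟩).1,
          hα _ ⟨by linarith, by linarith⟩]
        ring
    have hbound : E + C * (N + 1 : ℕ) ≤ E + C * ((N + 1 : ℕ) + 1) := by linarith
    -- the part of that piece on which the next iterate stays on the same side of `u` and `v`
    obtain ⟨a₂, b₂, ha₂, hb₂, ha₂z, hzb₂, ha₂C, hb₂C, hside⟩ : ∃ a₂ b₂, a₁ ≤ a₂ ∧ b₂ ≤ b₁ ∧
        a₂ ≤ z ∧ z < b₂ ∧ ConjBound d (E + C * ((N + 1 : ℕ) + 1)) a₂ ∧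
        ConjBound d (E + C * ((N + 1 : ℕ) + 1)) b₂ ∧
        ∀ w ∈ Ico a₂ b₂, (w + (t + α) ∈ Ico u v ↔ z + (t + α) ∈ Ico u v) := by
      have hu' := (hu.sub htα).mono hbound
      have hv' := (hv.sub htα).mono hbound
      rcases lt_or_ge (z + (t + α)) u with h | h
      · refine ⟨a₁, min b₁ (u - (t + α)), le_rfl, min_le_left _ _, ha₁z,
          lt_min hzb₁ (by linarith), ha₁C, hb₁C.min hu', fun w hw => iff_of_false ?_ ?_⟩
        · exact fun h' => by linarith [h'.1, (lt_min_iff.1 hw.2).2]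
        · exact fun h' => by linarith [h'.1]
      rcases lt_or_ge (z + (t + α)) v with h' | h'
      · refine ⟨max a₁ (u - (t + α)), min b₁ (v - (t + α)), le_max_left _ _, min_le_left _ _,
          max_le ha₁z (by linarith), lt_min hzb₁ (by linarith), ha₁C.max hu', hb₁C.min hv',
          fun w hw => iff_of_true ⟨?_, ?_⟩ ⟨h, h'⟩⟩
        · linarith [(max_le_iff.1 hw.1).2]
        · linarith [(lt_min_iff.1 hw.2).2]
      · refine ⟨max a₁ (v - (t + α)), b₁, le_max_left _ _, le_rfl, max_le ha₁z (by linarith), hzb₁,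
          ha₁C.max hv', hb₁C, fun w hw => iff_of_false ?_ ?_⟩
        · exact fun h'' => by linarith [h''.2, (max_le_iff.1 hw.1).2]
        · exact fun h'' => by linarith [h''.2]
    refine ⟨a₂, b₂, by linarith, ha₂z, hzb₂, by linarith, ha₂C, hb₂C, fun i hi => ?_⟩
    rcases Nat.le_succ_iff.1 hi with hi' | rfl
    · obtain ⟨t', ht', h⟩ := hit i hi'
      exact ⟨t', ht', fun w hw => h w ⟨by linarith [hw.1], by linarith [hw.2]⟩⟩
    · refine ⟨t + α, htα, fun w hw => ?_⟩
      have hw' : w ∈ Ico a₁ b₁ := ⟨by linarith [hw.1], by linarith [hw.2]⟩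
      rw [htr w hw', htr z ⟨ha₁z, hzb₁⟩]
      exact ⟨rfl, hside w hw⟩

end IsZsdTranslation

theorem log_div_le_sum_one_div {x : ℝ} (hx : 0 < x) (n : ℕ) :
    Real.log ((x + n) / x) ≤ ∑ i ∈ Finset.range n, 1 / (x + i) := by
  induction n with
  | zero => simp [hx.ne']
  | succ n ih =>
    have hxn : 0 < x + n := by positivity
    rw [Finset.sum_range_succ]
    have h1 : (x + (n + 1 : ℕ)) / x = (x + n) / x * (1 + 1 / (x + n)) := by
      push_cast
      field_simp
      ring
    rw [h1, Real.log_mul (by positivity) (by positivity)]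
    have := Real.log_le_sub_one_of_pos (x := 1 + 1 / (x + n)) (by positivity)
    linarith

namespace IsZsdTranslation

variable {d : ℤ} {C l r u v z : ℝ} {T : Equiv.Perm ℝ}

/-- If `z ∈ [u,v)` does not come back to `[u,v)` before time `L`, then `L` is bounded linearly in
the reciprocal length. -/
theorem noReturn_bound (hd : Irrational √d) (hT : IsZsdTranslation d C l r T) (hC : 0 < C)
    (hsub : Ico u v ⊆ Ico l r) {x : ℝ} (hx : 0 ≤ x)
    (hu : ConjBound d (C * x) u) (hv : ConjBound d (C * x) v)
    (hz : z ∈ Ico u v) (L : ℕ) (hL : ∀ n, 1 ≤ n → n < L → (T ^ n) z ∉ Ico u v) :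
    x + 1 + L ≤ (x + 1) * Real.exp (2 * C * (r - l)) := by
  have hlr : l ≤ r := ((hsub hz).1.trans_lt (hsub hz).2).le
  choose a b hua haz hzb hbv ha hb hit using
    fun N : ℕ => hT.exists_piece hC.le hsub hu hv hz N
  choose t ht htr using fun N : ℕ => hit N N le_rfl
  have hlen : ∀ N : ℕ, 1 / (2 * C) * (1 / (x + 1 + N)) ≤ b N - a N := by
    intro N
    have h := ((hb N).sub (ha N)).one_le_mul_of_pos hd (by linarith [haz N, hzb N])
    rw [← one_div_mul_one_div, div_mul_div_comm, div_mul_div_comm, div_le_iff₀ (by positivity)]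
    linarith
  have hdisj : ∀ i i' : ℕ, i' < L → i < i' →
      Disjoint (Ico (a i + t i) (b i + t i)) (Ico (a i' + t i') (b i' + t i')) := by
    intro i i' hi' hlt
    rw [Set.disjoint_left]
    intro y hy hy'
    have hw : y - t i ∈ Ico (a i) (b i) := ⟨by linarith [hy.1], by linarith [hy.2]⟩
    have hw' : y - t i' ∈ Ico (a i') (b i') := ⟨by linarith [hy'.1], by linarith [hy'.2]⟩
    have h1 : (T ^ i) (y - t i) = y := by rw [(htr i _ hw).1, sub_add_cancel]
    have h2 : (T ^ i') (y - t i') = y := by rw [(htr i' _ hw').1, sub_add_cancel]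
    have h3 : y - t i = (T ^ (i' - i)) (y - t i') := by
      apply (T ^ i).injective
      rw [h1, ← Equiv.Perm.mul_apply, ← pow_add, Nat.add_sub_cancel' hlt.le, h2]
    obtain ⟨_, -, h4⟩ := hit i' (i' - i) (by omega)
    refine hL (i' - i) (by omega) (by omega) ((h4 _ hw').2.1 ?_)
    rw [← h3]
    exact ⟨(hua i).trans hw.1, hw.2.trans_le (hbv i)⟩
  have hsum := sum_length_le_of_pairwiseDisjoint_Ico (Finset.range L) (fun i => a i + t i)
    (fun i => b i + t i) hlr (fun i _ => by linarith [haz i, hzb i]) ?_ ?_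
  · simp only [add_sub_add_right_eq_sub] at hsum
    have h1 := Finset.sum_le_sum fun i (_ : i ∈ Finset.range L) => hlen i
    rw [← Finset.mul_sum] at h1
    have h2 := log_div_le_sum_one_div (x := x + 1) (by linarith) L
    have h3 : Real.log ((x + 1 + L) / (x + 1)) ≤ 2 * C * (r - l) := by
      refine h2.trans ?_
      have h4 := h1.trans hsum
      rwa [one_div_mul_eq_div, div_le_iff₀' (by positivity)] at h4
    rw [Real.log_le_iff_le_exp (by positivity), div_le_iff₀' (by positivity)] at h3
    exact h3
  · intro i _ y hy
    have hw : y - t i ∈ Ico (a i) (b i) := ⟨by linarith [hy.1], by linarith [hy.2]⟩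
    have h1 : (T ^ i) (y - t i) = y := by rw [(htr i _ hw).1, sub_add_cancel]
    rw [← h1]
    exact hT.pow_mem (hsub ⟨(hua i).trans hw.1, hw.2.trans_le (hbv i)⟩) i
  · intro i hi i' hi' hne
    rcases lt_or_gt_of_ne hne with h | h
    · exact hdisj i i' (Finset.mem_range.1 hi') h
    · exact (hdisj i' i (Finset.mem_range.1 hi) h).symm

end IsZsdTranslation

theorem inducedMap_mapsTo {T : Equiv.Perm ℝ} {I : Set ℝ}
    (hret : ∀ z ∈ I, ∃ n, 0 < n ∧ (T ^ n) z ∈ I) : MapsTo (inducedMap T I) I I :=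
  fun z hz => (Nat.sInf_mem (s := {n : ℕ | 0 < n ∧ (T ^ n) z ∈ I}) (hret z hz)).2

theorem inducedMap_injOn {T : Equiv.Perm ℝ} {I : Set ℝ}
    (hret : ∀ z ∈ I, ∃ n, 0 < n ∧ (T ^ n) z ∈ I) : InjOn (inducedMap T I) I := by
  have key : ∀ z ∈ I, ∀ w ∈ I, inducedMap T I z = inducedMap T I w →
      ¬ returnTime T I z < returnTime T I w := by
    intro z hz w hw h hlt
    have hpos : 0 < returnTime T I z :=
      (Nat.sInf_mem (s := {n : ℕ | 0 < n ∧ (T ^ n) z ∈ I}) (hret z hz)).1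
    have hz' : z = (T ^ (returnTime T I w - returnTime T I z)) w := by
      apply (T ^ returnTime T I z).injective
      rw [← Equiv.Perm.mul_apply, ← pow_add, Nat.add_sub_cancel' hlt.le]
      exact h
    have hle : returnTime T I w ≤ returnTime T I w - returnTime T I z :=
      Nat.sInf_le ⟨by omega, hz' ▸ hz⟩
    omega
  intro z hz w hw h
  have heq : returnTime T I z = returnTime T I w :=
    le_antisymm (not_lt.1 (key w hw z hz h.symm)) (not_lt.1 (key z hz w hw h))
  rw [inducedMap, inducedMap, heq] at h
  exact (T ^ returnTime T I w).injective h

theorem returnTime_eq_of_iff {T : Equiv.Perm ℝ} {I : Set ℝ} {z w : ℝ} {n : ℕ} (hn : 0 < n)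
    (hz : (T ^ n) z ∈ I) (h : ∀ i ≤ n, ((T ^ i) w ∈ I ↔ (T ^ i) z ∈ I)) :
    returnTime T I w = returnTime T I z := by
  have hzn : returnTime T I z ≤ n := Nat.sInf_le ⟨hn, hz⟩
  have hwn : returnTime T I w ≤ n := Nat.sInf_le ⟨hn, (h n le_rfl).2 hz⟩
  have hzmem : returnTime T I z ∈ {n : ℕ | 0 < n ∧ (T ^ n) z ∈ I} := Nat.sInf_mem ⟨n, hn, hz⟩
  have hwmem : returnTime T I w ∈ {n : ℕ | 0 < n ∧ (T ^ n) w ∈ I} :=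
    Nat.sInf_mem ⟨n, hn, (h n le_rfl).2 hz⟩
  exact le_antisymm (Nat.sInf_le ⟨hzmem.1, (h _ hzn).2 hzmem.2⟩)
    (Nat.sInf_le ⟨hwmem.1, (h _ hwn).1 hwmem.2⟩)

/-- Increasing enumeration of a finite subset of `[u,v]` containing both endpoints. -/
theorem exists_strictMono_range_eq {G : Set ℝ} (hG : G.Finite) {u v : ℝ} (hsub : G ⊆ Icc u v)
    (hu : u ∈ G) (hv : v ∈ G) :
    ∃ (j : ℕ) (e : Fin (j + 1) → ℝ), StrictMono e ∧ e 0 = u ∧ e (Fin.last j) = v ∧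
      Set.range e = G := by
  have hcard : 0 < hG.toFinset.card := Finset.card_pos.2 ⟨u, by simpa using hu⟩
  obtain ⟨j, hj⟩ := Nat.exists_eq_add_one.2 hcard
  set e := hG.toFinset.orderEmbOfFin hj with he
  have hrange : Set.range e = G := by rw [he, Finset.range_orderEmbOfFin, hG.coe_toFinset]
  refine ⟨j, e, e.strictMono, ?_, ?_, hrange⟩
  · obtain ⟨i, hi⟩ : u ∈ Set.range e := hrange ▸ hu
    refine le_antisymm (hi ▸ e.monotone (Fin.zero_le i)) (hsub ?_).1
    exact hrange ▸ Set.mem_range_self _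
  · obtain ⟨i, hi⟩ : v ∈ Set.range e := hrange ▸ hv
    refine le_antisymm (hsub ?_).2 (hi ▸ e.monotone (Fin.le_last i))
    exact hrange ▸ Set.mem_range_self _

namespace IsZsdTranslation

variable {d : ℤ} {C C' l r u v x z : ℝ} {T : Equiv.Perm ℝ}

protected theorem mono (hT : IsZsdTranslation d C l r T) (h : C ≤ C') :
    IsZsdTranslation d C' l r T := by
  refine ⟨hT.1, fun z hz => ?_⟩
  obtain ⟨p, q, α, hp, hq, hpC, hqC, hαC, hα⟩ := hT.2 z hz
  exact ⟨p, q, α, hp, hq, hpC.mono h, hqC.mono h, hαC.mono h, hα⟩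

/-- The first-return map to `[u,v)` is a translation on a semi-interval with controlled endpoints
around each point. -/
theorem exists_piece_inducedMap (hd : Irrational √d) (hT : IsZsdTranslation d C l r T)
    (hC : 0 < C) (hsub : Ico u v ⊆ Ico l r) (hx : 0 ≤ x)
    (hu : ConjBound d (C * x) u) (hv : ConjBound d (C * x) v) (hz : z ∈ Ico u v) :
    (∃ n, 0 < n ∧ (T ^ n) z ∈ Ico u v) ∧
    ∃ a b t, a ≤ z ∧ z < b ∧ b ≤ v ∧
      ConjBound d (C * (Real.exp (2 * C * (r - l)) + 2) * (x + 1)) b ∧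
      ∀ w ∈ Ico a b, inducedMap T (Ico u v) w = w + t := by
  set K := Real.exp (2 * C * (r - l)) with hK
  have hK0 : 0 < K := Real.exp_pos _
  set L := ⌊(x + 1) * K⌋₊ + 1 with hL
  have hLgt : (x + 1) * K < L := by
    rw [hL]
    push_cast
    exact Nat.lt_floor_add_one _
  have hLle : (L : ℝ) ≤ (x + 1) * K + 1 := by
    rw [hL]
    push_cast
    linarith [Nat.floor_le (show 0 ≤ (x + 1) * K by positivity)]
  obtain ⟨n, hn, hnL, hret⟩ : ∃ n, 1 ≤ n ∧ n < L ∧ (T ^ n) z ∈ Ico u v := by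
    by_contra! h
    have := hT.noReturn_bound hd hC hsub hx hu hv hz L h
    linarith
  refine ⟨⟨n, hn, hret⟩, ?_⟩
  obtain ⟨a, b, hua, haz, hzb, hbv, -, hb, hit⟩ := hT.exists_piece hC.le hsub hu hv hz L
  have htime : ∀ w ∈ Ico a b, returnTime T (Ico u v) w = returnTime T (Ico u v) z := by
    refine fun w hw => returnTime_eq_of_iff hn hret fun i hi => ?_
    obtain ⟨_, -, h⟩ := hit i (by omega)
    exact (h w hw).2
  have hle : returnTime T (Ico u v) z ≤ n := Nat.sInf_le ⟨hn, hret⟩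
  obtain ⟨t, -, ht⟩ := hit (returnTime T (Ico u v) z) (by omega)
  refine ⟨a, b, t, haz, hzb, hbv, hb.mono ?_, fun w hw => ?_⟩
  · rw [mul_assoc, ← mul_add]
    refine mul_le_mul_of_nonneg_left ?_ hC.le
    linarith
  · rw [inducedMap, htime w hw]
    exact (ht w hw).1

/-- The first-return map to `[u,v)` is an interval exchange whose separation points have
controlled conjugates. -/
theorem exists_inducedData (hd : Irrational √d) (hd1 : 1 ≤ d) (hT : IsZsdTranslation d C l r T)
    (hC : 0 < C) (hsub : Ico u v ⊆ Ico l r) (huv : u < v) (hx : 0 ≤ x)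
    (hu : ConjBound d (C * x) u) (hv : ConjBound d (C * x) v) :
    ∃ (j : ℕ) (e : Fin (j + 1) → ℝ) (σ : Equiv.Perm (Fin j)), StrictMono e ∧
      (∀ i, e i ∈ Icc u v ∧
        ConjBound d (C * (Real.exp (2 * C * (r - l)) + 2) * (x + 1)) (e i)) ∧
      InducedData T u v j (fun i => e i.succ - e i.castSucc) σ := by
  set K := Real.exp (2 * C * (r - l)) with hK
  have hK0 : 0 < K := Real.exp_pos _
  set R := C * (K + 2) * (x + 1) with hR
  have hCR : C * x ≤ R := by
    rw [hR, mul_assoc]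
    refine mul_le_mul_of_nonneg_left ?_ hC.le
    nlinarith
  set G : Set ℝ := {y | y ∈ Icc u v ∧ ConjBound d R y} with hG
  have hfin : G.Finite := by
    refine (ConjBound.finite_setOf hd1 (max R (max |u| |v|))).subset fun y hy => ?_
    exact ⟨hy.2.mono (le_max_left _ _), (abs_le_max_abs_abs hy.1.1 hy.1.2).trans (le_max_right _ _)⟩
  obtain ⟨j, e, he, h0, hlast, hrange⟩ := exists_strictMono_range_eq hfin (fun y hy => hy.1)
    ⟨⟨le_rfl, huv.le⟩, hu.mono hCR⟩ ⟨⟨huv.le, le_rfl⟩, hv.mono hCR⟩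
  have hmem : ∀ i, e i ∈ G := fun i => hrange ▸ Set.mem_range_self i
  have hpiece := fun z hz => hT.exists_piece_inducedMap (z := z) hd hC hsub hx hu hv hz
  have hret := fun z hz => (hpiece z hz).1
  obtain ⟨σ, S, hS, hSind⟩ := exists_isIET_of_translation he h0 hlast huv
    (inducedMap_mapsTo hret) (inducedMap_injOn hret) (by
      intro i w hw
      have hi : e i.castSucc ∈ Ico u v :=
        ⟨(hmem _).1.1, (he Fin.castSucc_lt_succ).trans_le (hmem i.succ).1.2⟩
      obtain ⟨-, a, b, t, ha, hb, hbv, hbC, ht⟩ := hpiece _ hi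
      obtain ⟨i', rfl⟩ : b ∈ Set.range e := hrange ▸ ⟨⟨hi.1.trans hb.le, hbv⟩, hbC⟩
      have hle : e i.succ ≤ e i' := he.monotone (Fin.castSucc_lt_iff_succ_le.1 (he.lt_iff_lt.1 hb))
      rw [ht w ⟨ha.trans hw.1, hw.2.trans_le hle⟩, ht _ ⟨ha, hb⟩]
      ring)
  exact ⟨j, e, σ, he, hmem, S, hS, hSind⟩

/-- Up to scaling, the first-return maps to semi-intervals of bounded reduced complexity have
lengths in a fixed finite set and a bounded number of intervals. -/
theorem exists_finite_scaled_inducedData (hd : Irrational √d) (hd1 : 1 ≤ d)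
    (hsq : ¬ IsSquare d) (hT : IsZsdTranslation d C l r T) (hC : 0 < C) :
    ∃ W : Set ℝ, W.Finite ∧ ∀ u v : ℝ, u < v → Ico u v ⊆ Ico l r →
      ConjBound d (C / (v - u)) u → ConjBound d (C / (v - u)) v →
      ∃ (j : ℕ) (lam : Fin j → ℝ) (σ : Equiv.Perm (Fin j)) (c : ℝ), 0 < c ∧
        InducedData T u v j lam σ ∧ j ≤ W.ncard ∧ ∀ i, c * lam i ∈ W := by
  obtain ⟨η, hη, hscale⟩ := exists_unit_scaling (by omega) hsq
  set K := Real.exp (2 * C * (r - l)) with hK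
  have hK0 : 0 < K := Real.exp_pos _
  have hη0 : 0 < η := by linarith
  set M := max (r - l) (2 * (C * (K + 2)) * (1 + (r - l)) * η / (r - l)) with hM
  refine ⟨{y | ConjBound d M y ∧ |y| ≤ M}, ConjBound.finite_setOf hd1 M, ?_⟩
  intro u v huv hsub hu hv
  have hlen : 0 < v - u := sub_pos.2 huv
  have hle : v - u ≤ r - l := by
    obtain ⟨h1, h2⟩ := (Set.Ico_subset_Ico_iff huv).1 hsub
    linarith
  have hD : 0 < r - l := hlen.trans_le hle
  obtain ⟨j, e, σ, he, hmem, hdata⟩ := hT.exists_inducedData hd hd1 hC hsub huv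
    (x := 1 / (v - u)) (by positivity) (by rwa [mul_one_div]) (by rwa [mul_one_div])
  obtain ⟨k, hk1, hk2⟩ := exists_nat_pow_near ((one_le_div hlen).2 hle) hη
  have hηk : 0 < η ^ k := by positivity
  have hW : ∀ i i', η ^ k * (e i - e i') ∈ {y | ConjBound d M y ∧ |y| ≤ M} := by
    intro i i'
    refine ⟨(hscale k _ _ ((hmem i).2.sub (hmem i').2)).mono (le_trans ?_ (le_max_right _ _)), ?_⟩
    · rw [pow_succ, div_lt_iff₀ hlen] at hk2
      rw [div_le_div_iff₀ hηk hD, ← two_mul]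
      have h1 : (1 / (v - u) + 1) * (v - u) ≤ 1 + (r - l) := by
        rw [add_mul, one_div_mul_cancel hlen.ne']
        linarith
      calc 2 * (C * (K + 2) * (1 / (v - u) + 1)) * (r - l)
          ≤ 2 * (C * (K + 2) * (1 / (v - u) + 1)) * (η ^ k * η * (v - u)) := by gcongr
        _ = 2 * (C * (K + 2)) * ((1 / (v - u) + 1) * (v - u)) * η * η ^ k := by ring
        _ ≤ _ := by gcongr
    · refine le_trans ?_ (le_max_left _ _)
      rw [le_div_iff₀ hlen] at hk1
      rw [abs_mul, abs_of_pos hηk]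
      refine le_trans (mul_le_mul_of_nonneg_left ?_ hηk.le) hk1
      obtain ⟨⟨h1, h2⟩, -⟩ := hmem i
      obtain ⟨⟨h3, h4⟩, -⟩ := hmem i'
      rw [abs_le]
      constructor <;> linarith
  refine ⟨j, _, σ, η ^ k, hηk, hdata, ?_, fun i => hW _ _⟩
  have hinj : Function.Injective fun i => η ^ k * (e i - e 0) := fun i i' h =>
    he.injective (sub_left_injective (mul_left_cancel₀ hηk.ne' h))
  have hcard := Set.ncard_le_ncard (Set.range_subset_iff.2 fun i => hW i 0)
    (ConjBound.finite_setOf hd1 M)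
  rw [Set.ncard_range_of_injective hinj, Nat.card_eq_fintype_card, Fintype.card_fin] at hcard
  omega

end IsZsdTranslation

theorem finite_setOf_iet_data {W : Set ℝ} (hW : W.Finite) (M : ℕ) :
    {p : Σ j : ℕ, Equiv.Perm (Fin j) × (Fin j → ℝ) | p.1 ≤ M ∧ ∀ i, p.2.2 i ∈ W}.Finite := by
  refine ((Set.finite_Iic M).biUnion fun j _ =>
    ((Set.finite_univ (α := Equiv.Perm (Fin j))).prod
      (Set.Finite.pi' fun _ : Fin j => hW)).image (Sigma.mk j)).subset ?_
  rintro ⟨j, σ, f⟩ ⟨hj, hf⟩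
  exact Set.mem_biUnion hj ⟨(σ, f), ⟨Set.mem_univ _, hf⟩, rfl⟩

/-- Boshernitzan. Let `T` be a minimal interval exchange
transformation on `[l,r)` defined over `ℤ[√d]` and `(Y_k)_{k ≥ 1}` a sequence of
semi-intervals `[u_k, v_k) ⊆ [l,r)` with endpoints in `ℤ[√d]` and bounded reduced
complexity. Then the induced transformations on the `Y_k` fall into finitely many
equivalence classes of interval exchange transformations. -/
theorem finitely_many_induced_classes_of_bounded_complexity (d : ℤ) (hd : 2 ≤ d)
    (hsf : Squarefree d) (s : ℕ) (l r : ℝ) (len : Fin s → ℝ)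
    (π : Equiv.Perm (Fin s)) (T : Equiv.Perm ℝ)
    (hIET : IsIET s l r len π T) (hmin : IsMinimalOn T l r)
    (hdef : DefinedOverZ d s l r len π)
    (u v : ℕ → ℝ) (huv : ∀ k, u k < v k)
    (hsub : ∀ k, Set.Ico (u k) (v k) ⊆ Set.Ico l r)
    (hZ : ∀ k, u k ∈ Zsd d ∧ v k ∈ Zsd d)
    (hbdd : ∃ B : ℝ, ∀ k, PiSet d (Set.Ico (u k) (v k)) ≤ B) :
    ∃ F : Finset ℕ, ∀ k : ℕ, ∃ m ∈ F,
      ∃ (j : ℕ) (lam mu : Fin j → ℝ) (σ₁ σ₂ : Equiv.Perm (Fin j)),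
        InducedData T (u k) (v k) j lam σ₁ ∧
        InducedData T (u m) (v m) j mu σ₂ ∧
        IETEquiv j σ₁ σ₂ lam mu := by
  obtain ⟨B, hB⟩ := hbdd
  have hsq : ¬ IsSquare d := by
    rintro ⟨a, rfl⟩
    rcases Int.isUnit_iff.1 (hsf a dvd_rfl) with rfl | rfl <;> norm_num at hd
  have hirr : Irrational √d := (irrational_sqrt_intCast_iff_of_nonneg (by omega)).2 hsq
  obtain ⟨C₀, hC₀, hT₀⟩ := exists_isZsdTranslation hIET hdef
  set C := max (C₀ + 1) ((1 + √d) * B)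
  have hC : 0 < C := lt_max_of_lt_left (by linarith)
  have hT : IsZsdTranslation d C l r T :=
    hT₀.mono ((le_add_of_nonneg_right zero_le_one).trans (le_max_left _ _))
  obtain ⟨W, hW, hdata⟩ := hT.exists_finite_scaled_inducedData hirr (by omega) hsq hC
  have hclass : ∀ k, ∃ p ∈ {p : Σ j : ℕ, Equiv.Perm (Fin j) × (Fin j → ℝ) |
      p.1 ≤ W.ncard ∧ ∀ i, p.2.2 i ∈ W}, ∃ (lam : Fin p.1 → ℝ) (c : ℝ), 0 < c ∧
        InducedData T (u k) (v k) p.1 lam p.2.1 ∧ ∀ i, c * lam i = p.2.2 i := by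
    intro k
    have hle : (1 + √d) * B / (v k - u k) ≤ C / (v k - u k) :=
      div_le_div_of_nonneg_right (le_max_right _ _) (sub_pos.2 (huv k)).le
    obtain ⟨hu, hv⟩ := ConjBound.of_PiSet_le (huv k) (hZ k).1 (hZ k).2 (hB k)
    obtain ⟨j, lam, σ, c, hc, hind, hj, hmem⟩ :=
      hdata (u k) (v k) (huv k) (hsub k) (hu.mono hle) (hv.mono hle)
    exact ⟨⟨j, σ, fun i => c * lam i⟩, ⟨hj, hmem⟩, lam, c, hc, hind, fun _ => rfl⟩
  choose p hp hpdata using hclass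
  have hfin : (p '' Set.univ).Finite :=
    (finite_setOf_iet_data hW W.ncard).subset (by rintro _ ⟨k, -, rfl⟩; exact hp k)
  obtain ⟨F, -, hFfin, hF⟩ := Set.exists_subset_image_finite_and.1
    ⟨p '' Set.univ, subset_rfl, hfin, rfl⟩
  refine ⟨hFfin.toFinset, fun k => ?_⟩
  obtain ⟨m, hm, hmk⟩ : p k ∈ p '' F := hF ▸ ⟨k, Set.mem_univ _, rfl⟩
  obtain ⟨lam, c, hc, hlam, hclam⟩ := hpdata k
  have hm_data := hpdata m
  rw [hmk] at hm_data
  obtain ⟨mu, c', hc', hmu, hcmu⟩ := hm_data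
  refine ⟨m, by simpa using hm, _, lam, mu, _, _, hlam, hmu,
    Or.inl ⟨c / c', div_pos hc hc', rfl, fun i => ?_⟩⟩
  rw [div_mul_eq_mul_div, eq_div_iff hc'.ne', mul_comm, hcmu, hclam]

end
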